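/- Let X, X₁, …, Xₙ be i.i.d. real-valued random variables, let τ > 0 with M(τ) > 0, and let a = (a₁, …, aₙ) with aₖ ∈ ℝ^d be such that 𝑁 = Σₖ aₖaₖᵀ is positive definite. Let α > 0, D > 0, γ ∈ (0,1), and suppose that (Σₖ(⟨t,aₖ⟩ − mₖ)²)^{1/2} ≥ min{γ‖t·a‖, α} for all integers m₁, …, mₙ and all t ∈ ℝ^d with ‖t‖ ≤ D. Then there exist absolute constants c₁, c₂ > 0 such that Q(F_a, dτ/D) ≤ c₁^d ( (√d/(D γ √M(τ)))^d (det 𝑁)^{-1/2} + exp(−c₂ α² M(τ)) ). -/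

import Mathlib

open MeasureTheory
open scoped RealInnerProductSpace

/-- Concentration function `Q(μ, r) = sup_x μ(x + rB)` of a measure on `ℝ^d`. -/
noncomputable def concFn {d : ℕ} (μ : Measure (EuclideanSpace ℝ (Fin d))) (r : ℝ) : ℝ :=
  ⨆ x : EuclideanSpace ℝ (Fin d), (μ (Metric.closedBall x r)).toReal

/-- Law of `S_a = ∑ k, X_k • a_k`, where `X_1, …, X_n` are i.i.d. with law `ν`. -/
noncomputable def sumLaw {d n : ℕ} (ν : Measure ℝ) (a : Fin n → EuclideanSpace ℝ (Fin d)) :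
    Measure (EuclideanSpace ℝ (Fin d)) :=
  (Measure.pi fun _ : Fin n => ν).map (fun ω => ∑ k, ω k • a k)

/-- `M(τ) = E min(X̃²/τ², 1)`, where `X̃ = X₁ - X₂` with `X₁, X₂` i.i.d. of law `ν`. -/
noncomputable def Mfn (ν : Measure ℝ) (τ : ℝ) : ℝ :=
  ∫ p : ℝ × ℝ, min ((p.1 - p.2) ^ 2 / τ ^ 2) 1 ∂(ν.prod ν)

/-- The matrix `𝑁 = ∑ k, aₖ aₖᵀ`. -/
noncomputable def covMat {d n : ℕ} (a : Fin n → EuclideanSpace ℝ (Fin d)) :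
    Matrix (Fin d) (Fin d) ℝ :=
  Matrix.of fun i j => ∑ k, a k i * a k j

/-- The squared tent function, the square of `max (1 - |u|) 0`. -/
noncomputable def sqTent (u : ℝ) : ℝ := (max (1 - |u|) 0) ^ 2

lemma continuous_sqTent : Continuous sqTent := by
  unfold sqTent; fun_prop

lemma sqTent_nonneg (u : ℝ) : 0 ≤ sqTent u := sq_nonneg _

lemma sqTent_le_one (u : ℝ) : sqTent u ≤ 1 :=
  pow_le_one₀ (le_max_right _ _) (max_le (by linarith [abs_nonneg u]) zero_le_one)

lemma sqTent_eq_zero {u : ℝ} (hu : 1 ≤ |u|) : sqTent u = 0 := by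
  simp [sqTent, max_eq_right (sub_nonpos.2 hu)]

lemma sqTent_neg (u : ℝ) : sqTent (-u) = sqTent u := by simp [sqTent]

lemma integrable_sqTent : Integrable sqTent := by
  refine continuous_sqTent.integrable_of_hasCompactSupport ?_
  refine HasCompactSupport.intro (isCompact_Icc (a := (-1 : ℝ)) (b := 1)) fun u hu => ?_
  refine sqTent_eq_zero ?_
  by_contra! h
  exact hu (abs_le.1 h.le)

/-- The Fourier transform of the squared tent. -/
noncomputable def sqTentFT (x : ℝ) : ℝ := ∫ u, sqTent u * Real.cos (x * u)

lemma sqTentFT_eq_intervalIntegral (x : ℝ) :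
    sqTentFT x = 2 * ∫ u in (0 : ℝ)..1, (1 - u) ^ 2 * Real.cos (x * u) := by
  have h1 := integral_comp_abs (f := fun u : ℝ => (max (1 - u) 0) ^ 2 * Real.cos (x * u))
  have h2 : ∀ u : ℝ, Real.cos (x * |u|) = Real.cos (x * u) := by
    intro u
    rcases abs_choice u with h | h <;> simp [h]
  simp only [h2] at h1
  rw [sqTentFT]
  unfold sqTent
  rw [h1, intervalIntegral.integral_of_le zero_le_one]
  congr 1
  rw [setIntegral_eq_of_subset_of_forall_sdiff_eq_zero measurableSet_Ioi
    (Set.Ioc_subset_Ioi_self : Set.Ioc (0 : ℝ) 1 ⊆ Set.Ioi 0)]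
  · refine setIntegral_congr_fun measurableSet_Ioc fun u hu => ?_
    simp only [max_eq_left (sub_nonneg.2 hu.2)]
  · rintro u ⟨hu, hu'⟩
    have : 1 ≤ u := by
      by_contra! h
      exact hu' ⟨hu, h.le⟩
    simp [max_eq_right (sub_nonpos.2 this)]

lemma sqTentFT_zero : sqTentFT 0 = 2 / 3 := by
  rw [sqTentFT_eq_intervalIntegral]
  have h : ∀ u ∈ Set.uIcc (0 : ℝ) 1, HasDerivAt (fun u : ℝ => -(1 - u) ^ 3 / 3)
      ((1 - u) ^ 2 * Real.cos (0 * u)) u := by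
    intro u _
    convert! ((((hasDerivAt_id u).const_sub 1).pow 3).neg.div_const 3) using 1
    simp
  rw [intervalIntegral.integral_eq_sub_of_hasDerivAt h
    (Continuous.intervalIntegrable (by fun_prop) _ _)]
  norm_num

lemma sqTentFT_of_ne_zero {x : ℝ} (hx : x ≠ 0) :
    sqTentFT x = 4 * (x - Real.sin x) / x ^ 3 := by
  rw [sqTentFT_eq_intervalIntegral]
  have h : ∀ u ∈ Set.uIcc (0 : ℝ) 1, HasDerivAt
      (fun u : ℝ => (1 - u) ^ 2 * Real.sin (x * u) / x - 2 * (1 - u) * Real.cos (x * u) / x ^ 2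
        - 2 * Real.sin (x * u) / x ^ 3)
      ((1 - u) ^ 2 * Real.cos (x * u)) u := by
    intro u _
    have hm : HasDerivAt (fun u : ℝ => x * u) x u := by
      simpa using (hasDerivAt_id u).const_mul x
    have h1 : HasDerivAt (fun u : ℝ => 1 - u) (-1) u := by
      simpa using (hasDerivAt_id u).const_sub 1
    convert! ((((h1.pow 2).mul hm.sin).div_const x).sub
      (((h1.const_mul 2).mul hm.cos).div_const (x ^ 2))).sub
      ((hm.sin.const_mul 2).div_const (x ^ 3)) using 1
    simp
    field_simp
    ring
  rw [intervalIntegral.integral_eq_sub_of_hasDerivAt h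
    (Continuous.intervalIntegrable (by fun_prop) _ _)]
  simp
  field_simp
  ring

lemma sqTentFT_neg (x : ℝ) : sqTentFT (-x) = sqTentFT x := by
  simp [sqTentFT]

lemma sqTentFT_lower (x : ℝ) : 1 / 5 ≤ sqTentFT x * (1 + x ^ 2) := by
  wlog hx : 0 ≤ x generalizing x
  · simpa [sqTentFT_neg] using this (-x) (by linarith)
  rcases hx.eq_or_lt with rfl | hx
  · norm_num [sqTentFT_zero]
  rw [sqTentFT_of_ne_zero hx.ne', div_mul_eq_mul_div, le_div_iff₀ (by positivity)]
  have key : ∀ y : ℝ, 0 ≤ y → y ≤ 1 → y ^ 3 / 10 ≤ y - Real.sin y := by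
    intro y h0 h1
    have := (abs_le.1 (Real.sin_bound (abs_le.2 ⟨by linarith, h1⟩))).2
    rw [abs_of_nonneg h0] at this
    have h5 : y ^ 5 ≤ y ^ 3 := pow_le_pow_of_le_one h0 h1 (by norm_num)
    linarith [pow_nonneg h0 3]
  rcases le_total x 1 with h1 | h1
  · have := key x hx.le h1
    nlinarith [pow_pos hx 3, mul_nonneg (sub_nonneg.2 this) (sq_nonneg x), pow_pos hx 5]
  rcases le_total x 2 with h2 | h2
  · have hmono : 1 / 10 ≤ x - Real.sin x := by
      have h3 : Monotone fun y : ℝ => y - Real.sin y := by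
        refine monotone_of_deriv_nonneg (by fun_prop) fun y => ?_
        have : HasDerivAt (fun y : ℝ => y - Real.sin y) (1 - Real.cos y) y :=
          (hasDerivAt_id y).sub (Real.hasDerivAt_sin y)
        rw [this.deriv]
        linarith [Real.cos_le_one y]
      have h4 := h3 h1
      have h5 := key 1 zero_le_one le_rfl
      simp only at h4
      linarith
    nlinarith [mul_nonneg (sub_nonneg.2 hmono) (sq_nonneg x), sq_nonneg (x - 1),
      mul_nonneg (sub_nonneg.2 h2) (sq_nonneg x)]
  · have : 1 ≤ x - Real.sin x := by linarith [Real.sin_le_one x]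
    have h6 : x / 2 ≤ x - Real.sin x := by linarith [Real.sin_le_one x]
    nlinarith [mul_nonneg (sub_nonneg.2 h6) (sq_nonneg x), pow_pos hx 3]

lemma sqTentFT_pos (x : ℝ) : 0 < sqTentFT x :=
  pos_of_mul_pos_left (lt_of_lt_of_le (by norm_num) (sqTentFT_lower x)) (by positivity)

lemma sqTentFT_upper (x : ℝ) : sqTentFT x * (1 + x ^ 2) ≤ 16 := by
  wlog hx : 0 ≤ x generalizing x
  · simpa [sqTentFT_neg] using this (-x) (by linarith)
  rcases hx.eq_or_lt with rfl | hx
  · norm_num [sqTentFT_zero]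
  rw [sqTentFT_of_ne_zero hx.ne', div_mul_eq_mul_div, div_le_iff₀ (by positivity)]
  rcases le_total x 1 with h1 | h1
  · have := (abs_le.1 (Real.sin_bound (abs_le.2 ⟨by linarith, h1⟩))).1
    rw [abs_of_nonneg hx.le] at this
    have h5 : x ^ 5 ≤ x ^ 3 := pow_le_pow_of_le_one hx.le h1 (by norm_num)
    have h6 : x - Real.sin x ≤ x ^ 3 / 5 := by linarith [pow_nonneg hx.le 3]
    nlinarith [mul_nonneg (sub_nonneg.2 h6) (sq_nonneg x), pow_pos hx 3]
  · have h6 : x - Real.sin x ≤ 1 + x := by linarith [Real.neg_one_le_sin x]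
    have h7 : 1 ≤ x ^ 2 := one_le_pow₀ h1
    nlinarith [mul_nonneg (sub_nonneg.2 h6) (sq_nonneg x), mul_pos hx hx, pow_pos hx 3,
      mul_nonneg (sub_nonneg.2 h7) hx.le,
      mul_nonneg (sub_nonneg.2 h1) (sq_nonneg x)]

lemma sqTentFT_scale {w : ℝ} (hw : 1 ≤ |w|) (x : ℝ) : sqTentFT (w * x) ≤ 80 * sqTentFT x := by
  have h1 := sqTentFT_upper (w * x)
  have h2 := sqTentFT_lower x
  have hw2 : 1 ≤ w ^ 2 := by rw [← sq_abs]; nlinarith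
  have h3 : sqTentFT (w * x) * (1 + x ^ 2) ≤ 16 := by
    refine le_trans (mul_le_mul_of_nonneg_left ?_ (sqTentFT_pos _).le) h1
    nlinarith [sq_nonneg x]
  refine le_of_mul_le_mul_right (a := 1 + x ^ 2) ?_ (by positivity)
  linarith

lemma integral_sqTent_mul_cexp (x : ℝ) :
    ∫ u : ℝ, (sqTent u : ℂ) * Complex.exp ((x * u : ℝ) * Complex.I) = (sqTentFT x : ℂ) := by
  have hint : Integrable fun u : ℝ => (sqTent u : ℂ) * Complex.exp ((x * u : ℝ) * Complex.I) := by
    refine integrable_sqTent.ofReal.mul_bdd (c := 1) (by fun_prop) ?_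
    exact .of_forall fun u => by rw [Complex.norm_exp_ofReal_mul_I]
  apply Complex.ext
  · rw [← RCLike.re_eq_complex_re, ← integral_re hint]
    simp [sqTentFT, Complex.exp_ofReal_mul_I_re, -Complex.ofReal_mul]
  · rw [← RCLike.im_eq_complex_im, ← integral_im hint]
    simp only [RCLike.im_to_complex, Complex.im_ofReal_mul, Complex.exp_ofReal_mul_I_im,
      Complex.ofReal_im]
    have := integral_neg_eq_self (fun u : ℝ => sqTent u * Real.sin (x * u)) volume
    simp only [sqTent_neg, mul_neg, Real.sin_neg, integral_neg] at this
    linarith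

open scoped Matrix MatrixOrder ComplexOrder in
lemma integral_exp_neg_mul_sum_inner_sq {d n : ℕ} (a : Fin n → EuclideanSpace ℝ (Fin d))
    (ha : (covMat a).PosDef) {b : ℝ} (hb : 0 < b) :
    ∫ u : EuclideanSpace ℝ (Fin d), Real.exp (-b * ∑ k, ⟪u, a k⟫ ^ 2) =
      Real.sqrt (Real.pi / b) ^ d * (1 / Real.sqrt (covMat a).det) := by
  obtain ⟨B, hB⟩ := CStarAlgebra.nonneg_iff_eq_star_mul_self.mp ha.posSemidef.nonneg
  have hB' : covMat a = Bᵀ * B := by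
    rw [hB, Matrix.star_eq_conjTranspose, Matrix.conjTranspose_eq_transpose_of_trivial]
  let A : Matrix (Fin n) (Fin d) ℝ := Matrix.of fun k i => a k i
  have hA : covMat a = Aᵀ * A := by
    ext i j
    simp [covMat, A, Matrix.mul_apply]
  have hquad : ∀ {m : ℕ} (C : Matrix (Fin m) (Fin d) ℝ) (v : Fin d → ℝ),
      ∑ k, (C *ᵥ v) k ^ 2 = v ⬝ᵥ ((Cᵀ * C) *ᵥ v) := by
    intro m C v
    rw [← Matrix.mulVec_mulVec, Matrix.dotProduct_mulVec, Matrix.vecMul_transpose]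
    simp [dotProduct, sq]
  let L := Matrix.toLpLin 2 2 B
  have hnorm : ∀ u : EuclideanSpace ℝ (Fin d), ∑ k, ⟪u, a k⟫ ^ 2 = ‖L u‖ ^ 2 := by
    intro u
    rw [EuclideanSpace.norm_sq_eq]
    have h1 : ∀ k, ⟪u, a k⟫ = (A *ᵥ u.ofLp) k := by
      intro k
      simp [PiLp.inner_apply, A, Matrix.mulVec, dotProduct]
    simp only [h1, Real.norm_eq_abs, sq_abs, L, Matrix.ofLp_toLpLin, Matrix.toLin'_apply]
    rw [hquad, hquad, ← hA, ← hB']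
  have hdet : (covMat a).det = B.det ^ 2 := by
    rw [hB', Matrix.det_mul, Matrix.det_transpose, sq]
  have hB0 : B.det ≠ 0 := by
    intro h
    have := ha.det_pos
    rw [hdet, h] at this
    norm_num at this
  have hL : LinearMap.det L = B.det := LinearMap.det_toLpLin 2 B
  simp_rw [hnorm]
  have hmap := Measure.map_linearMap_addHaar_eq_smul_addHaar
    (volume : Measure (EuclideanSpace ℝ (Fin d))) (f := L) (by rwa [hL])
  have := integral_map (μ := (volume : Measure (EuclideanSpace ℝ (Fin d)))) (φ := L)
    L.continuous_of_finiteDimensional.aemeasurable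
    (f := fun v => Real.exp (-b * ‖v‖ ^ 2)) (by fun_prop)
  rw [← this, hmap, integral_smul_measure, GaussianFourier.integral_rexp_neg_mul_sq_norm hb,
    ENNReal.toReal_ofReal (abs_nonneg _), hL, hdet, Real.sqrt_sq_eq_abs, abs_inv, smul_eq_mul,
    one_div, mul_comm, finrank_euclideanSpace_fin, Real.sqrt_eq_rpow, ← Real.rpow_natCast,
    ← Real.rpow_mul (by positivity)]
  ring_nf

/-- The measure on `ℝ^d` whose density is the product of squared tents. -/
noncomputable def sqTentMeasure (d : ℕ) : Measure (EuclideanSpace ℝ (Fin d)) :=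
  volume.withDensity fun u => ENNReal.ofReal (∏ i, sqTent (u i))

lemma measurable_prod_sqTent (d : ℕ) :
    Measurable fun u : EuclideanSpace ℝ (Fin d) => ∏ i, sqTent (u i) := by
  have := continuous_sqTent
  exact Continuous.measurable (by fun_prop)

lemma sqTentMeasure_le (d : ℕ) : sqTentMeasure d ≤ volume := by
  conv_rhs => rw [← withDensity_one (μ := (volume : Measure (EuclideanSpace ℝ (Fin d))))]
  refine withDensity_mono (.of_forall fun u => ?_)
  simp only [Pi.one_apply, ENNReal.ofReal_le_one]
  exact Finset.prod_le_one (fun i _ => sqTent_nonneg _) fun i _ => sqTent_le_one _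

lemma ae_sqTentMeasure_norm_le (d : ℕ) : ∀ᵐ u ∂sqTentMeasure d, ‖u‖ ≤ Real.sqrt d := by
  rw [sqTentMeasure, ae_withDensity_iff (measurable_prod_sqTent d).ennreal_ofReal]
  refine .of_forall fun u hu => ?_
  have h : ∀ i, |u i| < 1 := by
    intro i
    by_contra! h
    exact hu (by rw [Finset.prod_eq_zero (Finset.mem_univ i) (sqTent_eq_zero h),
      ENNReal.ofReal_zero])
  rw [EuclideanSpace.norm_eq]
  refine Real.sqrt_le_sqrt ?_
  calc ∑ i, ‖u i‖ ^ 2 ≤ ∑ _i : Fin d, (1 : ℝ) := Finset.sum_le_sum fun i _ => by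
        rw [Real.norm_eq_abs]; exact pow_le_one₀ (abs_nonneg _) (h i).le
    _ = d := by simp

lemma charFun_sqTentMeasure (d : ℕ) (y : EuclideanSpace ℝ (Fin d)) :
    charFun (sqTentMeasure d) y = ((∏ i, sqTentFT (y i) : ℝ) : ℂ) := by
  have h0 : ∀ u : EuclideanSpace ℝ (Fin d), 0 ≤ ∏ i, sqTent (u i) := fun u =>
    Finset.prod_nonneg fun i _ => sqTent_nonneg _
  rw [charFun_apply, sqTentMeasure, integral_withDensity_eq_integral_toReal_smul
    (measurable_prod_sqTent d).ennreal_ofReal (.of_forall fun _ => ENNReal.ofReal_lt_top)]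
  simp_rw [ENNReal.toReal_ofReal (h0 _)]
  rw [← (EuclideanSpace.volume_preserving_symm_measurableEquiv_toLp (Fin d)).symm.integral_comp
    (MeasurableEquiv.measurableEmbedding _)]
  push_cast
  simp_rw [← integral_sqTent_mul_cexp]
  rw [← integral_fintype_prod_volume_eq_prod]
  congr 1
  ext u
  simp [Finset.prod_mul_distrib, ← Complex.exp_sum, PiLp.inner_apply, Finset.sum_mul]

instance (d : ℕ) : IsFiniteMeasure (sqTentMeasure d) := by
  have h : Integrable fun u : EuclideanSpace ℝ (Fin d) => ∏ i, sqTent (u i) := by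
    rw [← (EuclideanSpace.volume_preserving_symm_measurableEquiv_toLp (Fin d)).symm.integrable_comp_emb
      (MeasurableEquiv.measurableEmbedding _)]
    exact Integrable.fintype_prod (f := fun _ => sqTent) fun _ => integrable_sqTent
  exact isFiniteMeasure_withDensity_ofReal h.2

lemma sqTentMeasure_real_univ_le (d : ℕ) : (sqTentMeasure d).real Set.univ ≤ 1 := by
  have h := charFun_sqTentMeasure d 0
  rw [charFun_zero] at h
  have h' : (sqTentMeasure d).real Set.univ = (2 / 3) ^ d := by
    have : (sqTentMeasure d).real Set.univ = ∏ i : Fin d, sqTentFT 0 := by exact_mod_cast h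
    rw [this, Finset.prod_const, sqTentFT_zero, Finset.card_univ, Fintype.card_fin]
  rw [h']
  exact pow_le_one₀ (by norm_num) (by norm_num)

lemma integral_prod_sqTentFT {d : ℕ} (μ : Measure (EuclideanSpace ℝ (Fin d))) [IsFiniteMeasure μ]
    (c : ℝ) (x : EuclideanSpace ℝ (Fin d)) :
    ((∫ y, ∏ i, sqTentFT (c * (y i - x i)) ∂μ : ℝ) : ℂ) =
      ∫ u, Complex.exp (((-c * ⟪x, u⟫ : ℝ) : ℂ) * Complex.I) * charFun μ (c • u)
        ∂sqTentMeasure d := by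
  have h1 : ∀ y : EuclideanSpace ℝ (Fin d), ((∏ i, sqTentFT (c * (y i - x i)) : ℝ) : ℂ) =
      ∫ u, Complex.exp (((c * ⟪y - x, u⟫ : ℝ) : ℂ) * Complex.I) ∂sqTentMeasure d := by
    intro y
    have := charFun_sqTentMeasure d (c • (y - x))
    simp only [PiLp.smul_apply, PiLp.sub_apply, smul_eq_mul] at this
    rw [← this, charFun_apply]
    simp_rw [inner_smul_right, real_inner_comm]
  rw [← integral_complex_ofReal]
  simp_rw [h1]
  rw [integral_integral_swap]
  · congr 1
    ext u
    rw [charFun_apply, ← integral_const_mul]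
    congr 1
    ext y
    rw [← Complex.exp_add, ← add_mul, ← Complex.ofReal_add, inner_smul_right, inner_sub_left]
    ring_nf
  · refine Integrable.of_bound (Continuous.aestronglyMeasurable ?_) 1 (.of_forall fun p => ?_)
    · simp only [Function.uncurry_def]
      fun_prop
    · simp only [Function.uncurry_def]
      rw [Complex.norm_exp_ofReal_mul_I]

lemma integral_prod_sqTentFT_le {d : ℕ} (μ : Measure (EuclideanSpace ℝ (Fin d)))
    [IsFiniteMeasure μ] (c : ℝ) (x : EuclideanSpace ℝ (Fin d)) :
    ∫ y, ∏ i, sqTentFT (c * (y i - x i)) ∂μ ≤ ∫ u, ‖charFun μ (c • u)‖ ∂sqTentMeasure d := by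
  have h := congrArg norm (integral_prod_sqTentFT μ c x)
  rw [Complex.norm_real] at h
  refine (le_abs_self _).trans (h.le.trans ((norm_integral_le_integral_norm _).trans_eq ?_))
  simp_rw [norm_mul, Complex.norm_exp_ofReal_mul_I, one_mul]

lemma integral_prod_sqTentFT_of_real {d : ℕ} (μ : Measure (EuclideanSpace ℝ (Fin d)))
    [IsFiniteMeasure μ] (c : ℝ) {g : EuclideanSpace ℝ (Fin d) → ℝ}
    (hg : ∀ u, charFun μ u = g u) :
    ∫ y, ∏ i, sqTentFT (c * y i) ∂μ = ∫ u, g (c • u) ∂sqTentMeasure d := by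
  have h := integral_prod_sqTentFT μ c 0
  simp only [PiLp.zero_apply, sub_zero, inner_zero_left, mul_zero, Complex.ofReal_zero, zero_mul,
    Complex.exp_zero, one_mul, hg, integral_complex_ofReal] at h
  exact_mod_cast h

instance {d n : ℕ} (ν : Measure ℝ) [IsProbabilityMeasure ν] (a : Fin n → EuclideanSpace ℝ (Fin d)) :
    IsProbabilityMeasure (sumLaw ν a) :=
  Measure.isProbabilityMeasure_map (Measurable.aemeasurable (by fun_prop))

lemma charFun_sumLaw {d n : ℕ} (ν : Measure ℝ) [IsProbabilityMeasure ν]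
    (a : Fin n → EuclideanSpace ℝ (Fin d)) (u : EuclideanSpace ℝ (Fin d)) :
    charFun (sumLaw ν a) u = ∏ k, charFun ν ⟪u, a k⟫ := by
  simp_rw [charFun_apply]
  rw [sumLaw, integral_map (Measurable.aemeasurable (by fun_prop)) (by fun_prop),
    ← integral_fintype_prod_eq_prod]
  congr 1
  ext ω
  rw [← Complex.exp_sum, ← Finset.sum_mul, sum_inner, Complex.ofReal_sum]
  congr 3
  ext k
  rw [real_inner_smul_left, real_inner_comm (a k) u, Real.inner_apply]

/-- The law of a symmetrized Poisson variable. -/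
lemma exists_charFun_eq_exp_neg_mul_one_sub_cos {l : ℝ} (hl : 0 ≤ l) :
    ∃ η : Measure ℝ, IsProbabilityMeasure η ∧
      ∀ t, charFun η t = (Real.exp (-l * (1 - Real.cos t)) : ℂ) := by
  let r : NNReal := ⟨l / 2, by positivity⟩
  let P : Measure ℝ := (ProbabilityTheory.poissonMeasure r).map Nat.cast
  have hP : IsProbabilityMeasure P := Measure.isProbabilityMeasure_map (by fun_prop)
  have hP' : IsProbabilityMeasure (P.map fun x => (-1 : ℝ) * x) :=
    Measure.isProbabilityMeasure_map (by fun_prop)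
  refine ⟨P.conv (P.map fun x => (-1 : ℝ) * x), inferInstance, fun t => ?_⟩
  rw [charFun_conv, charFun_map_mul, ProbabilityTheory.charFun_map_cast_poissonMeasure,
    ProbabilityTheory.charFun_map_cast_poissonMeasure, ← Complex.exp_add]
  push_cast
  have hr : ((r : ℝ) : ℂ) = l / 2 := by
    change ((l / 2 : ℝ) : ℂ) = l / 2
    push_cast
    rfl
  rw [hr, Complex.cos]
  ring_nf

lemma integral_exp_neg_cos_scale_le {d n : ℕ} (a : Fin n → EuclideanSpace ℝ (Fin d)) {l : ℝ}
    (hl : 0 ≤ l) (c : ℝ) {w : ℝ} (hw : 1 ≤ |w|) :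
    ∫ u, Real.exp (-l * ∑ k, (1 - Real.cos ⟪(w * c) • u, a k⟫)) ∂sqTentMeasure d ≤
      80 ^ d * ∫ u, Real.exp (-l * ∑ k, (1 - Real.cos ⟪c • u, a k⟫)) ∂sqTentMeasure d := by
  obtain ⟨η, hη, hη'⟩ := exists_charFun_eq_exp_neg_mul_one_sub_cos hl
  have hg : ∀ u, charFun (sumLaw η a) u =
      (Real.exp (-l * ∑ k, (1 - Real.cos ⟪u, a k⟫)) : ℝ) := by
    intro u
    rw [charFun_sumLaw, Finset.mul_sum, Real.exp_sum]
    simp [hη']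
  have hcont : ∀ c : ℝ, Integrable (fun y : EuclideanSpace ℝ (Fin d) => ∏ i, sqTentFT (c * y i))
      (sumLaw η a) := by
    intro c
    have h1 : ∀ y : EuclideanSpace ℝ (Fin d), ((∏ i, sqTentFT (c * y i) : ℝ) : ℂ) =
        charFun (sqTentMeasure d) (c • y) := by
      intro y
      simp [charFun_sqTentMeasure]
    have h2 : Integrable (fun y => charFun (sqTentMeasure d) (c • y)) (sumLaw η a) := by
      refine Integrable.of_bound (C := (sqTentMeasure d).real Set.univ) ?_
        (.of_forall fun y => norm_charFun_le _)
      exact (measurable_charFun.comp (by fun_prop)).aestronglyMeasurable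
    refine h2.re.congr (.of_forall fun y => ?_)
    simp only [← h1, RCLike.re_eq_complex_re, Complex.ofReal_re]
  rw [← integral_prod_sqTentFT_of_real _ _ hg, ← integral_prod_sqTentFT_of_real _ _ hg,
    ← integral_const_mul]
  refine integral_mono (hcont _) ((hcont c).const_mul _) fun y => ?_
  calc ∏ i, sqTentFT (w * c * y i) ≤ ∏ i, 80 * sqTentFT (c * y i) := by
        refine Finset.prod_le_prod (fun i _ => (sqTentFT_pos _).le) fun i _ => ?_
        rw [mul_assoc]
        exact sqTentFT_scale hw _
    _ = 80 ^ d * ∏ i, sqTentFT (c * y i) := by simp [Finset.prod_mul_distrib]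

lemma norm_charFun_le_exp (ν : Measure ℝ) [IsProbabilityMeasure ν] (t : ℝ) :
    ‖charFun ν t‖ ≤
      Real.exp (-(1 / 2) * ∫ p : ℝ × ℝ, (1 - Real.cos (t * (p.1 - p.2))) ∂ν.prod ν) := by
  have hsq : ‖charFun ν t‖ ^ 2 = ∫ p : ℝ × ℝ, Real.cos (t * (p.1 - p.2)) ∂ν.prod ν := by
    have h1 : ((‖charFun ν t‖ ^ 2 : ℝ) : ℂ) =
        ∫ p : ℝ × ℝ, Complex.exp (((t * (p.1 - p.2) : ℝ) : ℂ) * Complex.I) ∂ν.prod ν := by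
      rw [← Complex.normSq_eq_norm_sq, ← Complex.mul_conj, ← charFun_neg, charFun_apply_real,
        charFun_apply_real, ← integral_prod_mul]
      congr 1
      ext p
      rw [← Complex.exp_add]
      push_cast
      ring_nf
    have h2 := congrArg Complex.re h1
    rw [Complex.ofReal_re] at h2
    rw [h2, ← RCLike.re_eq_complex_re, ← integral_re]
    · simp [Complex.exp_ofReal_mul_I_re, -Complex.ofReal_mul, -Complex.ofReal_sub]
    · refine Integrable.of_bound (by fun_prop) 1 (.of_forall fun p => ?_)
      rw [Complex.norm_exp_ofReal_mul_I]
  rw [integral_sub (integrable_const _), ← hsq]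
  · refine le_of_sq_le_sq ?_ (Real.exp_nonneg _)
    rw [← Real.exp_nat_mul]
    have := Real.add_one_le_exp (‖charFun ν t‖ ^ 2 - 1)
    simp only [integral_const, probReal_univ, smul_eq_mul]
    refine le_trans (by linarith) (this.trans_eq (by congr 1; push_cast; ring))
  · refine Integrable.of_bound (by fun_prop) 1 (.of_forall fun p => ?_)
    exact Real.abs_cos_le_one _

/-- Jensen's inequality for `exp` after a change of measure with density proportional to `m`. -/
lemma exp_neg_integral_le {Ω : Type*} [MeasurableSpace Ω] (P : Measure Ω) [IsProbabilityMeasure P]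
    {m F : Ω → ℝ} (hm : Measurable m) (hm0 : ∀ p, 0 ≤ m p) (hmi : Integrable m P)
    (hM : 0 < ∫ p, m p ∂P) (hF : Measurable F) (hF0 : ∀ p, 0 ≤ F p) (hFi : Integrable F P)
    (hmF : ∀ p, m p = 0 → F p = 0) {c : ℝ} (hc : 0 ≤ c) :
    IsProbabilityMeasure (P.withDensity fun p => ENNReal.ofReal (m p / ∫ p, m p ∂P)) ∧
    Real.exp (-c * ∫ p, F p ∂P) ≤ ∫ p, Real.exp (-(c * ∫ p, m p ∂P) * (F p / m p))
      ∂P.withDensity fun p => ENNReal.ofReal (m p / ∫ p, m p ∂P) := by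
  set M := ∫ p, m p ∂P with hMdef
  have hd : Measurable fun p => ENNReal.ofReal (m p / M) := by fun_prop
  have hdr : ∀ p, (ENNReal.ofReal (m p / M)).toReal = m p / M := fun p =>
    ENNReal.toReal_ofReal (div_nonneg (hm0 p) hM.le)
  set Q := P.withDensity fun p => ENNReal.ofReal (m p / M) with hQ
  have hprob : IsProbabilityMeasure Q := by
    refine ⟨?_⟩
    rw [hQ, withDensity_apply _ MeasurableSet.univ, setLIntegral_univ,
      ← ofReal_integral_eq_lintegral_ofReal (hmi.div_const _)
        (.of_forall fun p => div_nonneg (hm0 p) hM.le), integral_div, ← hMdef, div_self hM.ne',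
      ENNReal.ofReal_one]
  refine ⟨hprob, ?_⟩
  have hpt : ∀ p, m p / M * (-(c * M) * (F p / m p)) = -c * F p := by
    intro p
    by_cases h : m p = 0
    · simp [h, hmF p h]
    · field_simp
  have hint : Integrable (fun p => -(c * M) * (F p / m p)) Q := by
    rw [hQ, integrable_withDensity_iff_integrable_smul' hd
      (.of_forall fun _ => ENNReal.ofReal_lt_top)]
    simp_rw [hdr, smul_eq_mul, hpt]
    exact hFi.const_mul _
  have heq : -c * ∫ p, F p ∂P = ∫ p, -(c * M) * (F p / m p) ∂Q := by
    rw [hQ, integral_withDensity_eq_integral_toReal_smul hd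
      (.of_forall fun _ => ENNReal.ofReal_lt_top)]
    simp_rw [hdr, smul_eq_mul, hpt]
    rw [integral_const_mul]
  rw [heq]
  refine convexOn_exp.map_integral_le Real.continuous_exp.continuousOn isClosed_univ
    (.of_forall fun _ => Set.mem_univ _) hint ?_
  refine Integrable.of_bound
    (Real.measurable_exp.comp ((hF.div hm).const_mul _)).aestronglyMeasurable 1
    (.of_forall fun p => ?_)
  rw [Function.comp_apply, Real.norm_eq_abs, Real.abs_exp, Real.exp_le_one_iff, neg_mul,
    neg_nonpos]
  have := hm0 p
  have := hF0 p
  positivity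

lemma eight_mul_sq_sub_round_le (x : ℝ) :
    8 * (x - round x) ^ 2 ≤ 1 - Real.cos (2 * Real.pi * x) := by
  have h1 := abs_sub_round x
  have h2 : Real.cos (2 * Real.pi * x) = Real.cos (2 * Real.pi * (x - round x)) := by
    rw [← Real.cos_sub_int_mul_two_pi _ (round x)]
    ring_nf
  have h3 : |2 * Real.pi * (x - round x)| ≤ Real.pi := by
    rw [abs_mul, abs_of_pos Real.two_pi_pos]
    nlinarith [Real.pi_pos]
  have h4 := Real.cos_le_one_sub_mul_cos_sq h3
  rw [← h2] at h4
  have h5 : 2 / Real.pi ^ 2 * (2 * Real.pi * (x - round x)) ^ 2 = 8 * (x - round x) ^ 2 := by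
    field_simp [Real.pi_ne_zero]
    ring
  linarith

/-- The lattice-distance condition: `t·a` stays away from the integer points for `‖t‖ ≤ D`. -/
def LatticeAvoiding {d n : ℕ} (a : Fin n → EuclideanSpace ℝ (Fin d)) (α D γ : ℝ) : Prop :=
  ∀ (m : Fin n → ℤ) (t : EuclideanSpace ℝ (Fin d)), ‖t‖ ≤ D →
    min (γ * Real.sqrt (∑ k, ⟪t, a k⟫ ^ 2)) α ≤ Real.sqrt (∑ k, (⟪t, a k⟫ - m k) ^ 2)

lemma LatticeAvoiding.min_sq_le {d n : ℕ} {a : Fin n → EuclideanSpace ℝ (Fin d)} {α D γ : ℝ}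
    (h : LatticeAvoiding a α D γ) (hα : 0 ≤ α) (hγ : 0 ≤ γ) {u : EuclideanSpace ℝ (Fin d)}
    (hu : ‖u‖ ≤ D) :
    8 * min (γ ^ 2 * (∑ k, ⟪u, a k⟫ ^ 2) / (4 * Real.pi ^ 2)) (α ^ 2) ≤
      ∑ k, (1 - Real.cos ⟪u, a k⟫) := by
  have hpi := Real.pi_pos
  have hpi3 := Real.pi_gt_three
  let t : EuclideanSpace ℝ (Fin d) := (1 / (2 * Real.pi)) • u
  have hut : ∀ k, ⟪u, a k⟫ = 2 * Real.pi * ⟪t, a k⟫ := by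
    intro k
    rw [real_inner_smul_left]
    field_simp
  have ht : ‖t‖ ≤ D := by
    refine le_trans ?_ hu
    rw [norm_smul, Real.norm_eq_abs, abs_of_pos (by positivity)]
    refine mul_le_of_le_one_left (norm_nonneg _) ?_
    rw [div_le_one (by positivity)]
    linarith
  have h1 := h (fun k => round ⟪t, a k⟫) t ht
  have h2 : γ ^ 2 * (∑ k, ⟪u, a k⟫ ^ 2) / (4 * Real.pi ^ 2) =
      (γ * Real.sqrt (∑ k, ⟪t, a k⟫ ^ 2)) ^ 2 := by
    rw [mul_pow, Real.sq_sqrt (Finset.sum_nonneg fun _ _ => sq_nonneg _)]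
    simp_rw [hut, mul_pow]
    rw [← Finset.mul_sum]
    field_simp
    ring
  have h3 : min ((γ * Real.sqrt (∑ k, ⟪t, a k⟫ ^ 2)) ^ 2) (α ^ 2) ≤
      ∑ k, (⟪t, a k⟫ - round ⟪t, a k⟫) ^ 2 := by
    rw [← Real.sq_sqrt (Finset.sum_nonneg fun k (_ : k ∈ Finset.univ) =>
      sq_nonneg (⟪t, a k⟫ - round ⟪t, a k⟫))]
    rcases le_total (γ * Real.sqrt (∑ k, ⟪t, a k⟫ ^ 2)) α with h4 | h4
    · rw [min_eq_left h4] at h1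
      exact (min_le_left _ _).trans (pow_le_pow_left₀ (by positivity) h1 2)
    · rw [min_eq_right h4] at h1
      exact (min_le_right _ _).trans (pow_le_pow_left₀ hα h1 2)
  rw [h2]
  refine (mul_le_mul_of_nonneg_left h3 (by norm_num)).trans ?_
  rw [Finset.mul_sum]
  refine Finset.sum_le_sum fun k _ => ?_
  rw [hut]
  exact eight_mul_sq_sub_round_le _

lemma LatticeAvoiding.integral_exp_le {d n : ℕ} {a : Fin n → EuclideanSpace ℝ (Fin d)}
    {α D γ : ℝ} (h : LatticeAvoiding a α D γ) (hd : 0 < d) (ha : (covMat a).PosDef)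
    (hα : 0 < α) (hD : 0 < D) (hγ : 0 < γ) {M w : ℝ} (hM : 0 < M) (hw0 : w ≠ 0) (hw : |w| ≤ 1) :
    ∫ u, Real.exp (-(M / 2 / w ^ 2) *
        ∑ k, (1 - Real.cos ⟪(w * (D / Real.sqrt d)) • u, a k⟫)) ∂sqTentMeasure d ≤
      (8 * (Real.sqrt d / (D * γ * Real.sqrt M))) ^ d * (1 / Real.sqrt (covMat a).det)
        + Real.exp (-4 * α ^ 2 * M) := by
  have hpi := Real.pi_pos
  have hd' : (0 : ℝ) < d := by exact_mod_cast hd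
  have hsd : 0 < Real.sqrt d := Real.sqrt_pos.2 hd'
  have hsM : 0 < Real.sqrt M := Real.sqrt_pos.2 hM
  set ρ := D / Real.sqrt d with hρ
  have hρ0 : 0 < ρ := by positivity
  have hw2 : 0 < w ^ 2 := by positivity
  have hw21 : w ^ 2 ≤ 1 := by
    rw [← sq_abs]
    exact pow_le_one₀ (abs_nonneg _) hw
  let b := M * γ ^ 2 * ρ ^ 2 / Real.pi ^ 2
  have hb : 0 < b := by positivity
  have hgauss := integral_exp_neg_mul_sum_inner_sq a ha hb
  have hdet : 0 < Real.sqrt (covMat a).det := Real.sqrt_pos.2 ha.det_pos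
  have hgi : Integrable fun u : EuclideanSpace ℝ (Fin d) =>
      Real.exp (-b * ∑ k, ⟪u, a k⟫ ^ 2) := by
    refine not_imp_comm.1 integral_undef ?_
    rw [hgauss]
    positivity
  have hpt : ∀ᵐ u ∂sqTentMeasure d, Real.exp (-(M / 2 / w ^ 2) *
        ∑ k, (1 - Real.cos ⟪(w * ρ) • u, a k⟫)) ≤
      Real.exp (-b * ∑ k, ⟪u, a k⟫ ^ 2) + Real.exp (-4 * α ^ 2 * M) := by
    filter_upwards [ae_sqTentMeasure_norm_le d] with u hu
    have hu' : ‖(w * ρ) • u‖ ≤ D := by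
      rw [norm_smul, norm_mul, Real.norm_eq_abs, Real.norm_eq_abs, abs_of_pos hρ0]
      calc |w| * ρ * ‖u‖ ≤ 1 * ρ * Real.sqrt d := by gcongr
        _ = D := by rw [hρ]; field_simp
    have h1 := h.min_sq_le hα.le hγ.le hu'
    have h2 : ∑ k, ⟪(w * ρ) • u, a k⟫ ^ 2 = w ^ 2 * ρ ^ 2 * ∑ k, ⟪u, a k⟫ ^ 2 := by
      simp_rw [real_inner_smul_left, mul_pow, ← Finset.mul_sum]
    rw [h2] at h1
    have hcoef : 0 ≤ M / 2 / w ^ 2 := by positivity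
    have h3 := mul_le_mul_of_nonneg_left h1 hcoef
    rcases min_choice (γ ^ 2 * (w ^ 2 * ρ ^ 2 * ∑ k, ⟪u, a k⟫ ^ 2) / (4 * Real.pi ^ 2)) (α ^ 2)
      with h4 | h4
    · rw [h4] at h3
      refine le_add_of_le_of_nonneg (Real.exp_le_exp.2 ?_) (Real.exp_nonneg _)
      have h5 : M / 2 / w ^ 2 *
          (8 * (γ ^ 2 * (w ^ 2 * ρ ^ 2 * ∑ k, ⟪u, a k⟫ ^ 2) / (4 * Real.pi ^ 2))) =
          b * ∑ k, ⟪u, a k⟫ ^ 2 := by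
        simp only [b]
        field_simp
        ring
      linarith
    · rw [h4] at h3
      refine le_add_of_nonneg_of_le (Real.exp_nonneg _) (Real.exp_le_exp.2 ?_)
      have h5 : M / 2 ≤ M / 2 / w ^ 2 := le_div_self (by positivity) hw2 hw21
      nlinarith [mul_le_mul_of_nonneg_right h5 (by positivity : 0 ≤ 8 * α ^ 2)]
  have hgK := hgi.mono_measure (sqTentMeasure_le d)
  refine (integral_mono_of_nonneg (.of_forall fun _ => Real.exp_nonneg _)
    (hgK.add (integrable_const _)) hpt).trans ?_
  rw [integral_add' hgK (integrable_const _)]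
  refine add_le_add ?_ ?_
  · refine (integral_mono_measure (sqTentMeasure_le d)
      (.of_forall fun _ => Real.exp_nonneg _) hgi).trans (hgauss.le.trans ?_)
    gcongr
    rw [Real.sqrt_le_left (by positivity)]
    have h1 : Real.pi / b = Real.pi ^ 3 * (Real.sqrt d / (D * γ * Real.sqrt M)) ^ 2 := by
      simp only [b, hρ, div_pow, mul_pow, Real.sq_sqrt hM.le]
      field_simp
    rw [h1, mul_pow]
    gcongr
    calc Real.pi ^ 3 ≤ 4 ^ 3 := by gcongr; exact Real.pi_le_four
      _ = 8 ^ 2 := by norm_num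
  · rw [integral_const, smul_eq_mul]
    exact mul_le_of_le_one_left (Real.exp_nonneg _) (sqTentMeasure_real_univ_le d)

/-- Esseen's inequality with the product of squared tents as smoothing kernel. -/
lemma concFn_le {d : ℕ} (μ : Measure (EuclideanSpace ℝ (Fin d)))
    [IsProbabilityMeasure μ] {c r : ℝ} (hc : c ^ 2 * r ^ 2 ≤ d) :
    concFn μ r ≤ 15 ^ d * ∫ u, ‖charFun μ (c • u)‖ ∂sqTentMeasure d := by
  refine ciSup_le fun x => ?_
  refine le_trans ?_ (mul_le_mul_of_nonneg_left (integral_prod_sqTentFT_le μ c x) (by positivity))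
  rw [← integral_const_mul]
  have hnn : ∀ y : EuclideanSpace ℝ (Fin d), 0 ≤ 15 ^ d * ∏ i, sqTentFT (c * (y i - x i)) :=
    fun y => mul_nonneg (by positivity) (Finset.prod_nonneg fun i _ => (sqTentFT_pos _).le)
  have hint : Integrable (fun y : EuclideanSpace ℝ (Fin d) =>
      15 ^ d * ∏ i, sqTentFT (c * (y i - x i))) μ := by
    have h1 : ∀ y : EuclideanSpace ℝ (Fin d), ((∏ i, sqTentFT (c * (y i - x i)) : ℝ) : ℂ) =
        charFun (sqTentMeasure d) (c • (y - x)) := by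
      intro y
      simp [charFun_sqTentMeasure]
    have h2 : Integrable (fun y => charFun (sqTentMeasure d) (c • (y - x))) μ := by
      refine Integrable.of_bound (C := (sqTentMeasure d).real Set.univ) ?_
        (.of_forall fun y => norm_charFun_le _)
      exact (measurable_charFun.comp (by fun_prop)).aestronglyMeasurable
    refine (h2.re.congr (.of_forall fun y => ?_)).const_mul _
    simp only [← h1, RCLike.re_eq_complex_re, Complex.ofReal_re]
  have hball : (μ (Metric.closedBall x r)).toReal = ∫ y, (Metric.closedBall x r).indicator 1 y ∂μ := by
    rw [integral_indicator_one Metric.isClosed_closedBall.measurableSet]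
    rfl
  rw [hball]
  refine integral_mono ((integrable_const (1 : ℝ)).indicator
    Metric.isClosed_closedBall.measurableSet) hint fun y => ?_
  refine Set.indicator_apply_le' (fun hy => ?_) fun _ => hnn y
  have hsum : ∑ i, (c * (y i - x i)) ^ 2 ≤ d := by
    rw [Metric.mem_closedBall, dist_eq_norm] at hy
    have h1 : ‖y - x‖ ^ 2 ≤ r ^ 2 := pow_le_pow_left₀ (norm_nonneg _) hy 2
    rw [EuclideanSpace.norm_sq_eq] at h1
    simp only [PiLp.sub_apply, Real.norm_eq_abs, sq_abs] at h1
    simp_rw [mul_pow, ← Finset.mul_sum]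
    exact (mul_le_mul_of_nonneg_left h1 (sq_nonneg c)).trans hc
  have hlow : ∀ z : ℝ, 1 / 5 * Real.exp (-z ^ 2) ≤ sqTentFT z := by
    intro z
    have h1 := sqTentFT_lower z
    have h2 := Real.add_one_le_exp (z ^ 2)
    have h3 : sqTentFT z * (1 + z ^ 2) ≤ sqTentFT z * Real.exp (z ^ 2) :=
      mul_le_mul_of_nonneg_left (by linarith) (sqTentFT_pos z).le
    rw [Real.exp_neg, ← div_eq_mul_inv, div_le_iff₀ (Real.exp_pos _)]
    linarith
  have hexp1 : (3 : ℝ)⁻¹ ≤ Real.exp (-1) := by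
    rw [Real.exp_neg]
    exact inv_anti₀ (Real.exp_pos _) (by linarith [Real.exp_one_lt_d9])
  calc (1 : ℝ) = 15 ^ d * ((1 / 5) ^ d * (3 : ℝ)⁻¹ ^ d) := by
        rw [← mul_pow, ← mul_pow]
        norm_num
    _ ≤ 15 ^ d * ((1 / 5) ^ d * Real.exp (-1) ^ d) := by gcongr
    _ ≤ 15 ^ d * ((1 / 5) ^ d * Real.exp (-∑ i, (c * (y i - x i)) ^ 2)) := by
        gcongr
        rw [← Real.exp_nat_mul, Real.exp_le_exp]
        linarith
    _ = 15 ^ d * ∏ i, 1 / 5 * Real.exp (-(c * (y i - x i)) ^ 2) := by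
        rw [Finset.prod_mul_distrib, ← Real.exp_sum, Finset.sum_neg_distrib]
        simp
    _ ≤ 15 ^ d * ∏ i, sqTentFT (c * (y i - x i)) := by
        gcongr with i
        exact hlow _

lemma norm_charFun_sumLaw_le {d n : ℕ} (ν : Measure ℝ) [IsProbabilityMeasure ν]
    (a : Fin n → EuclideanSpace ℝ (Fin d)) (u : EuclideanSpace ℝ (Fin d)) :
    ‖charFun (sumLaw ν a) u‖ ≤ Real.exp (-(1 / 2) *
      ∫ p : ℝ × ℝ, ∑ k, (1 - Real.cos (⟪u, a k⟫ * (p.1 - p.2))) ∂ν.prod ν) := by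
  rw [charFun_sumLaw, norm_prod, integral_finsetSum, Finset.mul_sum, Real.exp_sum]
  · exact Finset.prod_le_prod (fun _ _ => norm_nonneg _) fun k _ => norm_charFun_le_exp ν _
  · intro k _
    refine (integrable_const _).sub (Integrable.of_bound (by fun_prop) 1 (.of_forall fun p => ?_))
    exact Real.abs_cos_le_one _

lemma LatticeAvoiding.integral_exp_div_min_le {d n : ℕ} {a : Fin n → EuclideanSpace ℝ (Fin d)}
    {α D γ : ℝ} (h : LatticeAvoiding a α D γ) (hd : 0 < d) (ha : (covMat a).PosDef)
    (hα : 0 < α) (hD : 0 < D) (hγ : 0 < γ) {M w : ℝ} (hM : 0 < M) (hw0 : w ≠ 0) :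
    ∫ u, Real.exp (-(1 / 2 * M) * ((∑ k, (1 - Real.cos ⟪(w * (D / Real.sqrt d)) • u, a k⟫))
        / min (w ^ 2) 1)) ∂sqTentMeasure d ≤
      80 ^ d * ((8 * (Real.sqrt d / (D * γ * Real.sqrt M))) ^ d * (1 / Real.sqrt (covMat a).det)
        + Real.exp (-4 * α ^ 2 * M)) := by
  rcases le_total |w| 1 with hw | hw
  · have hw2 : min (w ^ 2) 1 = w ^ 2 :=
      min_eq_left (by rw [← sq_abs]; exact pow_le_one₀ (abs_nonneg _) hw)
    have hb := h.integral_exp_le hd ha hα hD hγ hM hw0 hw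
    rw [hw2]
    refine le_trans (le_of_eq ?_) (hb.trans (le_mul_of_one_le_left (by positivity)
      (one_le_pow₀ (by norm_num))))
    congr 1
    ext u
    ring_nf
  · have hw2 : min (w ^ 2) 1 = 1 :=
      min_eq_right (by rw [← sq_abs]; exact one_le_pow₀ hw)
    have hb := h.integral_exp_le hd ha hα hD hγ hM one_ne_zero (by simp)
    simp only [one_pow, div_one, one_mul] at hb
    have hs := integral_exp_neg_cos_scale_le a (l := M / 2) (by positivity) (D / Real.sqrt d) hw
    rw [hw2]
    refine le_trans (le_of_eq ?_) (hs.trans (mul_le_mul_of_nonneg_left hb (by positivity)))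
    congr 1
    ext u
    ring_nf

lemma LatticeAvoiding.integral_norm_charFun_le {d n : ℕ} {a : Fin n → EuclideanSpace ℝ (Fin d)}
    {α D γ : ℝ} (h : LatticeAvoiding a α D γ) (hd : 0 < d) (ha : (covMat a).PosDef)
    (hα : 0 < α) (hD : 0 < D) (hγ : 0 < γ) (ν : Measure ℝ) [IsProbabilityMeasure ν] {τ : ℝ}
    (hτ : 0 < τ) (hM : 0 < Mfn ν τ) :
    ∫ u, ‖charFun (sumLaw ν a) ((D / Real.sqrt d / τ) • u)‖ ∂sqTentMeasure d ≤
      80 ^ d * ((8 * (Real.sqrt d / (D * γ * Real.sqrt (Mfn ν τ)))) ^ d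
        * (1 / Real.sqrt (covMat a).det) + Real.exp (-4 * α ^ 2 * Mfn ν τ)) := by
  set s := D / Real.sqrt d / τ with hs
  let m : ℝ × ℝ → ℝ := fun p => min ((p.1 - p.2) ^ 2 / τ ^ 2) 1
  let F : EuclideanSpace ℝ (Fin d) → ℝ × ℝ → ℝ := fun u p =>
    ∑ k, (1 - Real.cos (⟪s • u, a k⟫ * (p.1 - p.2)))
  have hm : Measurable m := by
    apply Continuous.measurable
    simp only [m]
    fun_prop
  have hm0 : ∀ p, 0 ≤ m p := fun p => le_min (by positivity) zero_le_one
  have hmi : Integrable m (ν.prod ν) := by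
    refine Integrable.of_bound hm.aestronglyMeasurable 1 (.of_forall fun p => ?_)
    rw [Real.norm_eq_abs, abs_of_nonneg (hm0 p)]
    exact min_le_right _ _
  have hFc : Continuous (Function.uncurry F) := by
    simp only [F, Function.uncurry_def]
    fun_prop
  have hF0 : ∀ u p, 0 ≤ F u p := fun u p =>
    Finset.sum_nonneg fun k _ => sub_nonneg.2 (Real.cos_le_one _)
  have hFi : ∀ u, Integrable (F u) (ν.prod ν) := by
    intro u
    refine integrable_finsetSum _ fun k _ => (integrable_const _).sub
      (Integrable.of_bound (by fun_prop) 1 (.of_forall fun p => ?_))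
    exact Real.abs_cos_le_one _
  have hw : ∀ p, m p ≠ 0 → (p.1 - p.2) / τ ≠ 0 := by
    intro p hp h0
    refine hp ?_
    simp only [m]
    rw [← div_pow, h0]
    simp
  have hmF : ∀ u p, m p = 0 → F u p = 0 := by
    intro u p hp
    have : p.1 - p.2 = 0 := by
      by_contra hne
      have : 0 < m p := lt_min (by positivity) zero_lt_one
      exact this.ne' hp
    simp [F, this]
  have jensen := fun u => exp_neg_integral_le (ν.prod ν) hm hm0 hmi hM
    (hFc.measurable.comp measurable_prodMk_left) (hF0 u) (hFi u) (hmF u)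
    (by norm_num : (0 : ℝ) ≤ 1 / 2)
  set Q := (ν.prod ν).withDensity fun p => ENNReal.ofReal (m p / ∫ p, m p ∂ν.prod ν) with hQ
  have hQp : IsProbabilityMeasure Q := (jensen 0).1
  have hMm : ∫ p, m p ∂ν.prod ν = Mfn ν τ := rfl
  simp only [hMm] at jensen
  have hGi : Integrable (Function.uncurry fun (u : EuclideanSpace ℝ (Fin d)) (p : ℝ × ℝ) =>
      Real.exp (-(1 / 2 * Mfn ν τ) * (F u p / m p))) ((sqTentMeasure d).prod Q) := by
    refine Integrable.of_bound (Measurable.aestronglyMeasurable ?_) 1 (.of_forall fun q => ?_)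
    · exact Real.measurable_exp.comp ((hFc.measurable.div (hm.comp measurable_snd)).const_mul _)
    · rw [Function.uncurry_def, Real.norm_eq_abs, Real.abs_exp, Real.exp_le_one_iff, neg_mul,
        neg_nonpos]
      have := hm0 q.2
      have := hF0 q.1 q.2
      positivity
  calc ∫ u, ‖charFun (sumLaw ν a) (s • u)‖ ∂sqTentMeasure d
      ≤ ∫ u, ∫ p, Real.exp (-(1 / 2 * Mfn ν τ) * (F u p / m p)) ∂Q ∂sqTentMeasure d := by
        refine integral_mono_of_nonneg (.of_forall fun _ => norm_nonneg _)
          hGi.integral_prod_left (.of_forall fun u => ?_)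
        exact (norm_charFun_sumLaw_le ν a _).trans (jensen u).2
    _ = ∫ p, ∫ u, Real.exp (-(1 / 2 * Mfn ν τ) * (F u p / m p)) ∂sqTentMeasure d ∂Q :=
        integral_integral_swap hGi
    _ ≤ ∫ _p, 80 ^ d * ((8 * (Real.sqrt d / (D * γ * Real.sqrt (Mfn ν τ)))) ^ d
        * (1 / Real.sqrt (covMat a).det) + Real.exp (-4 * α ^ 2 * Mfn ν τ)) ∂Q := by
        refine integral_mono_ae hGi.integral_prod_right (integrable_const _) ?_
        have hae : ∀ᵐ p ∂Q, m p ≠ 0 := by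
          rw [hQ, ae_withDensity_iff (by fun_prop)]
          refine .of_forall fun p hp h0 => hp ?_
          simp [h0]
        filter_upwards [hae] with p hp
        refine le_trans (le_of_eq ?_)
          (h.integral_exp_div_min_le hd ha hα hD hγ hM (hw p hp))
        congr 1
        ext u
        have hk : ∀ k, ⟪s • u, a k⟫ * (p.1 - p.2) =
            ⟪((p.1 - p.2) / τ * (D / Real.sqrt d)) • u, a k⟫ := by
          intro k
          rw [real_inner_smul_left, real_inner_smul_left, hs]
          ring
        simp only [F, m, hk, div_pow]
    _ = _ := by simp

theorem stmt_6 :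
    ∃ c₁ c₂ : ℝ, 0 < c₁ ∧ 0 < c₂ ∧
      ∀ (d n : ℕ), 0 < d →
      ∀ (ν : Measure ℝ), IsProbabilityMeasure ν →
      ∀ τ : ℝ, 0 < τ → 0 < Mfn ν τ →
      ∀ (a : Fin n → EuclideanSpace ℝ (Fin d)),
      (covMat a).PosDef →
      ∀ α D γ : ℝ, 0 < α → 0 < D → 0 < γ → γ < 1 →
      (∀ (m : Fin n → ℤ) (t : EuclideanSpace ℝ (Fin d)),
        ‖t‖ ≤ D →
        min (γ * Real.sqrt (∑ k, ⟪t, a k⟫ ^ 2)) α ≤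
          Real.sqrt (∑ k, (⟪t, a k⟫ - m k) ^ 2)) →
      concFn (sumLaw ν a) (d * τ / D) ≤
        c₁ ^ d * ((Real.sqrt d / (D * γ * Real.sqrt (Mfn ν τ))) ^ d
            * (1 / Real.sqrt (covMat a).det)
          + Real.exp (-c₂ * α ^ 2 * Mfn ν τ)) := by
  refine ⟨15 * 80 * 8, 4, by norm_num, by norm_num, ?_⟩
  intro d n hd ν hν τ hτ hM a ha α D γ hα hD hγ _ h
  have hd' : (0 : ℝ) < d := by exact_mod_cast hd
  have hscale : (D / Real.sqrt d / τ) ^ 2 * (d * τ / D) ^ 2 ≤ d := by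
    refine le_of_eq ?_
    rw [div_pow, div_pow, Real.sq_sqrt hd'.le]
    field_simp
  refine (concFn_le (sumLaw ν a) hscale).trans ?_
  have hmain := LatticeAvoiding.integral_norm_charFun_le h hd ha hα hD hγ ν hτ hM
  refine (mul_le_mul_of_nonneg_left hmain (by positivity)).trans ?_
  set R := Real.sqrt d / (D * γ * Real.sqrt (Mfn ν τ))
  set V := 1 / Real.sqrt (covMat a).det
  set e := Real.exp (-4 * α ^ 2 * Mfn ν τ)
  have he : e ≤ 8 ^ d * e :=
    le_mul_of_one_le_left (Real.exp_nonneg _) (one_le_pow₀ (by norm_num))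
  calc 15 ^ d * (80 ^ d * ((8 * R) ^ d * V + e))
      ≤ 15 ^ d * (80 ^ d * ((8 * R) ^ d * V + 8 ^ d * e)) := by gcongr
    _ = (15 * 80 * 8) ^ d * (R ^ d * V + e) := by
        simp only [mul_pow]
        ring
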